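/- Abelianity condition, case m + n = 0 with n > 0 odd: let n > 0 be an odd integer and m = −n. Set s = q^{−(n−1)N/(2n)} and s* = q^{−(n+1)N/(2n)} (real rational powers of q). Then: (i) the surface condition holds, s^{−n} (s*)^{n} = q^{−N}; (ii) with c = N/n one has (s*)² = s² q^{−2c}; and (iii) for every x ∈ ℂ with x ≠ 0 and x² ∉ {q^t : t ∈ ℚ} (so that no theta factor vanishes), the structure function equals one: 𝒴_{−n,n}(x) := ℱ_n(x;s*) ℱ_{−n}(x;s*) / (ℱ_{−n}(x;s) ℱ_{n}(x;s)) = 1. -/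

import Mathlib

open Complex

noncomputable section

/-- single infinite Pochhammer symbol `(x;s)_∞`. -/
def poch1 (x s : ℂ) : ℂ := ∏' n : ℕ, (1 - x * s ^ n)

/-- Jacobi `Θ_s(x)` function. -/
def ThetaF (s x : ℂ) : ℂ := poch1 x s * poch1 (s * x⁻¹) s * poch1 s s

/-- the function `𝒰(x) = q^{2/N-2} Θ_{q^{2N}}(q²x²) Θ_{q^{2N}}(q²x⁻²) /
(Θ_{q^{2N}}(x²) Θ_{q^{2N}}(x⁻²))` for a real number `q ∈ (0,1)`. -/
def Ureal (N : ℕ) (q : ℝ) (x : ℂ) : ℂ :=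
  ((q ^ ((2 : ℝ) / N - 2) : ℝ) : ℂ) * ThetaF ((q : ℂ) ^ (2 * N)) ((q : ℂ) ^ 2 * x ^ 2) *
    ThetaF ((q : ℂ) ^ (2 * N)) ((q : ℂ) ^ 2 * (x⁻¹) ^ 2) /
    (ThetaF ((q : ℂ) ^ (2 * N)) (x ^ 2) * ThetaF ((q : ℂ) ^ (2 * N)) ((x⁻¹) ^ 2))

/-- the function `ℱ_a(x;s)`. -/
def Fa (N : ℕ) (q : ℝ) (a : ℤ) (x s : ℂ) : ℂ :=
  if 0 < a then ∏ ℓ ∈ Finset.range a.toNat, Ureal N q (s ^ ℓ * x)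
  else ∏ ℓ ∈ Finset.Icc 1 a.natAbs, (Ureal N q ((s ^ ℓ)⁻¹ * x))⁻¹

lemma summable_aux (x P : ℂ) (hP : ‖P‖ < 1) : Summable (fun n : ℕ => ‖-(x * P ^ n)‖) := by
  simp only [norm_neg, norm_mul, norm_pow]
  exact (summable_geometric_of_lt_one (norm_nonneg _) hP).mul_left _

lemma poch1_step (x P : ℂ) (hP : ‖P‖ < 1) : poch1 x P = (1 - x) * poch1 (P * x) P := by
  unfold poch1
  have h := multipliable_one_add_of_summable (summable_aux (P * x) P hP)
  have h2 : Multipliable (fun n : ℕ => (1 - x * P ^ (n + 1))) := by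
    refine h.congr ?_
    intro n
    ring
  rw [tprod_eq_zero_mul' (f := fun n : ℕ => (1 - x * P ^ n)) h2]
  congr 1
  · simp
  · apply tprod_congr
    intro n
    ring

lemma poch1_ne_zero (x P : ℂ) (hP : ‖P‖ < 1) (hx : ∀ n : ℕ, x * P ^ n ≠ 1) :
    poch1 x P ≠ 0 := by
  unfold poch1
  have h := tprod_one_add_ne_zero_of_summable (f := fun n : ℕ => -(x * P ^ n))
    (fun i h0 => hx i (by linear_combination -h0)) (summable_aux x P hP)
  simpa [sub_eq_add_neg] using h

lemma ThetaF_step (x P : ℂ) (hP : ‖P‖ < 1) (hP0 : P ≠ 0) (hx0 : x ≠ 0) (hx1 : x ≠ 1) :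
    ThetaF P (P * x) = -x⁻¹ * ThetaF P x := by
  unfold ThetaF
  have e : P * (P * x)⁻¹ = x⁻¹ := by field_simp
  rw [e, poch1_step x P hP, poch1_step x⁻¹ P hP]
  have : (1 - x⁻¹) = -x⁻¹ * (1 - x) := by field_simp; ring
  rw [this]
  ring

/-- Complex numbers that are nonzero and not rational powers of `q`. -/
def GoodPt (q : ℝ) (y : ℂ) : Prop := y ≠ 0 ∧ ∀ t : ℚ, y ≠ ((q ^ (t : ℝ) : ℝ) : ℂ)

lemma GoodPt.mul {q : ℝ} (hq : 0 < q) {y : ℂ} (h : GoodPt q y) (r : ℚ) :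
    GoodPt q (((q ^ (r : ℝ) : ℝ) : ℂ) * y) := by
  have hr : ((q ^ (r : ℝ) : ℝ) : ℂ) ≠ 0 := by
    exact_mod_cast (Real.rpow_pos_of_pos hq _).ne'
  refine ⟨mul_ne_zero hr h.1, fun t ht => h.2 (t - r) ?_⟩
  apply mul_left_cancel₀ hr
  rw [ht, ← Complex.ofReal_mul, ← Real.rpow_add hq]
  push_cast
  congr 2
  ring

lemma GoodPt.inv {q : ℝ} (hq : 0 < q) {y : ℂ} (h : GoodPt q y) : GoodPt q y⁻¹ := by
  refine ⟨inv_ne_zero h.1, fun t ht => h.2 (-t) ?_⟩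
  rw [inv_eq_iff_eq_inv] at ht
  rw [ht]
  push_cast
  rw [Real.rpow_neg hq.le]
  push_cast
  rfl

lemma GoodPt.mul_pow {q : ℝ} (hq : 0 < q) {y : ℂ} (h : GoodPt q y) (k : ℕ) :
    GoodPt q ((q : ℂ) ^ k * y) := by
  have := h.mul hq (k : ℚ)
  simpa using this

lemma GoodPt.ne_one {q : ℝ} {y : ℂ} (h : GoodPt q y) : y ≠ 1 := by
  simpa using h.2 0

lemma norm_P_lt {q : ℝ} (hq0 : 0 < q) (hq1 : q < 1) {k : ℕ} (hk : k ≠ 0) :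
    ‖(q : ℂ) ^ k‖ < 1 := by
  rw [norm_pow, Complex.norm_real, Real.norm_of_nonneg hq0.le]
  exact pow_lt_one₀ hq0.le hq1 hk

lemma ThetaF_ne_zero {q : ℝ} (hq0 : 0 < q) (hq1 : q < 1) {k : ℕ} (hk : k ≠ 0) {y : ℂ}
    (h : GoodPt q y) : ThetaF ((q : ℂ) ^ k) y ≠ 0 := by
  have hP := norm_P_lt hq0 hq1 hk
  have key : ∀ z : ℂ, GoodPt q z → poch1 z ((q : ℂ) ^ k) ≠ 0 := by
    intro z hz
    apply poch1_ne_zero _ _ hP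
    intro n
    have := (hz.mul_pow hq0 (k * n)).ne_one
    rwa [pow_mul, mul_comm] at this
  unfold ThetaF
  refine mul_ne_zero (mul_ne_zero (key _ h) (key _ ((h.inv hq0).mul_pow hq0 k))) ?_
  apply poch1_ne_zero _ _ hP
  intro n hn
  have h1 : ‖((q : ℂ) ^ k) ^ (n + 1)‖ < 1 := by
    rw [norm_pow]
    exact pow_lt_one₀ (norm_nonneg _) hP (by omega)
  rw [pow_succ', hn] at h1
  simp at h1

lemma Ureal_ne_zero {N : ℕ} (hN : 2 ≤ N) {q : ℝ} (hq0 : 0 < q) (hq1 : q < 1) {y : ℂ}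
    (h : GoodPt q (y ^ 2)) : Ureal N q y ≠ 0 := by
  have hk : 2 * N ≠ 0 := by omega
  have hi : GoodPt q ((y⁻¹) ^ 2) := by rw [inv_pow]; exact h.inv hq0
  have hc : ((q ^ ((2 : ℝ) / N - 2) : ℝ) : ℂ) ≠ 0 := by
    exact_mod_cast (Real.rpow_pos_of_pos hq0 _).ne'
  unfold Ureal
  exact div_ne_zero (mul_ne_zero (mul_ne_zero hc (ThetaF_ne_zero hq0 hq1 hk (h.mul_pow hq0 2)))
    (ThetaF_ne_zero hq0 hq1 hk (hi.mul_pow hq0 2)))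
    (mul_ne_zero (ThetaF_ne_zero hq0 hq1 hk h) (ThetaF_ne_zero hq0 hq1 hk hi))

lemma Ureal_step {N : ℕ} (hN : 2 ≤ N) {q : ℝ} (hq0 : 0 < q) (hq1 : q < 1) {y : ℂ}
    (h : GoodPt q (y ^ 2)) : Ureal N q ((q : ℂ) ^ N * y) = Ureal N q y := by
  have hk : 2 * N ≠ 0 := by omega
  have hP := norm_P_lt hq0 hq1 hk
  have hqc : (q : ℂ) ≠ 0 := by exact_mod_cast hq0.ne'
  have hP0 : (q : ℂ) ^ (2 * N) ≠ 0 := pow_ne_zero _ hqc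
  have hsq : ((q : ℂ) ^ N * y) ^ 2 = (q : ℂ) ^ (2 * N) * y ^ 2 := by ring
  have hPw := h.mul_pow hq0 (2 * N)
  unfold Ureal
  rw [inv_pow, inv_pow, hsq]
  generalize y ^ 2 = w at *
  have hw := h.1
  have hPi := hPw.inv hq0
  have hPiq := hPi.mul_pow hq0 2
  have hwq := h.mul_pow hq0 2
  have n1 := ThetaF_ne_zero hq0 hq1 hk h
  have n2 := ThetaF_ne_zero hq0 hq1 hk hPi
  have t1 := ThetaF_step _ _ hP hP0 h.1 h.ne_one
  have t2 := ThetaF_step _ _ hP hP0 hwq.1 hwq.ne_one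
  have t3 := ThetaF_step _ _ hP hP0 hPi.1 hPi.ne_one
  have t4 := ThetaF_step _ _ hP hP0 hPiq.1 hPiq.ne_one
  generalize (q : ℂ) ^ (2 * N) = P at *
  have e3 : P * (P * w)⁻¹ = w⁻¹ := by field_simp
  have e4 : P * ((q : ℂ) ^ 2 * (P * w)⁻¹) = (q : ℂ) ^ 2 * w⁻¹ := by field_simp
  have e2 : (q : ℂ) ^ 2 * (P * w) = P * ((q : ℂ) ^ 2 * w) := by ring
  rw [e3] at t3
  rw [e4] at t4
  rw [e2, t1, t2, t3, t4]
  generalize ThetaF P w = A at *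
  generalize ThetaF P (P * w)⁻¹ = B at *
  generalize ThetaF P ((q : ℂ) ^ 2 * (P * w)⁻¹) = C at *
  generalize ThetaF P ((q : ℂ) ^ 2 * w) = D at *
  field_simp

lemma Ureal_steps {N : ℕ} (hN : 2 ≤ N) {q : ℝ} (hq0 : 0 < q) (hq1 : q < 1) {y : ℂ}
    (h : GoodPt q (y ^ 2)) (j : ℕ) : Ureal N q (((q : ℂ) ^ N) ^ j * y) = Ureal N q y := by
  induction j with
  | zero => simp
  | succ j ih =>
    rw [pow_succ', mul_assoc, Ureal_step hN hq0 hq1, ih]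
    have := h.mul_pow hq0 (N * (j * 2))
    rw [_root_.mul_pow, ← pow_mul, ← pow_mul]
    exact this

lemma Fa_mul_Fa {N : ℕ} (hN : 2 ≤ N) {q : ℝ} (hq0 : 0 < q) (hq1 : q < 1) {x : ℂ}
    (h : GoodPt q (x ^ 2)) (n : ℤ) (hn : 0 < n) (σ : ℝ) (r : ℚ) (hσ : σ = q ^ (r : ℝ)) (j : ℕ)
    (hj : σ ^ n.toNat * (q ^ N) ^ j = 1) :
    Fa N q n x (σ : ℂ) * Fa N q (-n) x (σ : ℂ) = 1 := by
  obtain ⟨m, rfl⟩ := Int.eq_ofNat_of_zero_le hn.le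
  have hj' : (σ : ℂ) ^ m * ((q : ℂ) ^ N) ^ j = 1 := by
    simp only [Int.toNat_natCast] at hj
    exact_mod_cast hj
  have hσ0 : (σ : ℂ) ≠ 0 := by
    rw [hσ]
    exact_mod_cast (Real.rpow_pos_of_pos hq0 _).ne'
  have hgood : ∀ l : ℕ, GoodPt q (((σ : ℂ) ^ l * x) ^ 2) := by
    intro l
    have := h.mul hq0 (r * (l * 2 : ℕ))
    push_cast at this
    rw [_root_.mul_pow, ← pow_mul]
    convert this using 2
    rw [hσ, ← Complex.ofReal_pow, ← Real.rpow_natCast, ← Real.rpow_mul hq0.le]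
    push_cast
    rfl
  have h2 : ¬ (0 < -(m : ℤ)) := by omega
  unfold Fa
  rw [if_pos hn, if_neg h2]
  simp only [Int.toNat_natCast, Int.natAbs_neg, Int.natAbs_natCast]
  have key : ∏ l ∈ Finset.Icc 1 m, (Ureal N q (((σ : ℂ) ^ l)⁻¹ * x))⁻¹
      = ∏ l ∈ Finset.range m, (Ureal N q ((σ : ℂ) ^ l * x))⁻¹ := by
    refine Finset.prod_nbij' (fun l => m - l) (fun l => m - l) ?_ ?_ ?_ ?_ ?_
    · intro a ha; simp only [Finset.mem_Icc, Finset.mem_range] at *; omega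
    · intro a ha; simp only [Finset.mem_Icc, Finset.mem_range] at *; omega
    · intro a ha; simp only [Finset.mem_Icc] at *; omega
    · intro a ha; simp only [Finset.mem_range] at *; omega
    · intro a ha
      simp only [Finset.mem_Icc] at ha
      rw [← Ureal_steps hN hq0 hq1 (hgood (m - a)) j]
      congr 2
      rw [← mul_assoc]
      congr 1
      have : (σ : ℂ) ^ m = σ ^ (m - a) * σ ^ a := by rw [← pow_add]; congr 1; omega
      rw [this] at hj'
      apply inv_eq_of_mul_eq_one_left
      rw [← hj']
      ring
  rw [key, ← Finset.prod_mul_distrib]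
  apply Finset.prod_eq_one
  intro l _
  exact mul_inv_cancel₀ (Ureal_ne_zero hN hq0 hq1 (hgood l))

/-- Abelianity condition in the case `m + n = 0` with `n > 0` odd: with
`s = q^{-(n-1)N/(2n)}` and `s* = q^{-(n+1)N/(2n)}`, the surface condition
`s^{-n} (s*)^n = q^{-N}` holds, `(s*)² = s² q^{-2c}` with `c = N/n`, and the
structure function `𝒴_{-n,n}(x) = ℱ_n(x;s*) ℱ_{-n}(x;s*) / (ℱ_{-n}(x;s) ℱ_n(x;s))`
equals `1`. -/
theorem abelianity_opposite_case (N : ℕ) (hN : 2 ≤ N) (q : ℝ) (hq0 : 0 < q) (hq1 : q < 1)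
    (n : ℤ) (hn : 0 < n) (hodd : Odd n)
    (s sstar c : ℝ)
    (hs : s = q ^ (-(((n : ℝ) - 1) * (N : ℝ)) / (2 * (n : ℝ))))
    (hsstar : sstar = q ^ (-(((n : ℝ) + 1) * (N : ℝ)) / (2 * (n : ℝ))))
    (hc : c = (N : ℝ) / (n : ℝ)) :
    s ^ (-n) * sstar ^ n = q ^ (-(N : ℤ)) ∧
    sstar ^ 2 = s ^ 2 * q ^ (-(2 * c)) ∧
    ∀ x : ℂ, x ≠ 0 → (∀ t : ℚ, x ^ 2 ≠ ((q ^ (t : ℝ) : ℝ) : ℂ)) →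
      Fa N q n x (sstar : ℂ) * Fa N q (-n) x (sstar : ℂ) /
        (Fa N q (-n) x (s : ℂ) * Fa N q n x (s : ℂ)) = 1 := by
  have hnR : (n : ℝ) ≠ 0 := by exact_mod_cast hn.ne'
  have hspos : 0 < s := by rw [hs]; exact Real.rpow_pos_of_pos hq0 _
  refine ⟨?_, ?_, ?_⟩
  · rw [hs, hsstar, ← Real.rpow_intCast, ← Real.rpow_intCast, ← Real.rpow_intCast,
      ← Real.rpow_mul hq0.le, ← Real.rpow_mul hq0.le, ← Real.rpow_add hq0]
    congr 1
    push_cast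
    field_simp
    ring
  · rw [hs, hsstar, hc, ← Real.rpow_natCast, ← Real.rpow_natCast,
      ← Real.rpow_mul hq0.le, ← Real.rpow_mul hq0.le, ← Real.rpow_add hq0]
    congr 1
    push_cast
    field_simp
    ring
  · intro x hx hxt
    have hgood : GoodPt q (x ^ 2) := ⟨pow_ne_zero _ hx, hxt⟩
    obtain ⟨k', hk'⟩ := hodd
    obtain ⟨k, rfl⟩ := Int.eq_ofNat_of_zero_le (show 0 ≤ k' by omega)
    have hnk : (n : ℝ) = 2 * k + 1 := by rw [hk']; push_cast; ring
    have hnn : ((n.toNat : ℕ) : ℝ) = n := by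
      exact_mod_cast Int.toNat_of_nonneg hn.le
    have h1 : Fa N q n x (s : ℂ) * Fa N q (-n) x (s : ℂ) = 1 := by
      refine Fa_mul_Fa hN hq0 hq1 hgood n hn s (-(((n : ℚ) - 1) * N) / (2 * n)) ?_ k ?_
      · rw [hs]; push_cast; rfl
      · rw [hs, ← pow_mul, ← Real.rpow_natCast, ← Real.rpow_natCast, ← Real.rpow_mul hq0.le,
          ← Real.rpow_add hq0, hnn]
        refine Eq.trans ?_ (Real.rpow_zero q)
        congr 1
        push_cast
        field_simp
        rw [hnk]
        ring
    have h2 : Fa N q n x (sstar : ℂ) * Fa N q (-n) x (sstar : ℂ) = 1 := by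
      refine Fa_mul_Fa hN hq0 hq1 hgood n hn sstar (-(((n : ℚ) + 1) * N) / (2 * n)) ?_ (k + 1) ?_
      · rw [hsstar]; push_cast; rfl
      · rw [hsstar, ← pow_mul, ← Real.rpow_natCast, ← Real.rpow_natCast, ← Real.rpow_mul hq0.le,
          ← Real.rpow_add hq0, hnn]
        refine Eq.trans ?_ (Real.rpow_zero q)
        congr 1
        push_cast
        field_simp
        rw [hnk]
        ring
    rw [h2, mul_comm, h1]
    simp

end
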